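/- arXiv:2011.04938 — 2 statements merged into one kernel-verified Lean document; each statement's English description precedes it below -/
import Mathlib

section
/- Let 0 < α < 1, T > 0 and let c : [0,T] → ℝ be absolutely continuous. Then for almost every t ∈ (0,T] the Caputo fractional derivatives of c and of c² exist and satisfy c(t) · (^{C}D^α_{0+}c)(t) ≥ (1/2) (^{C}D^α_{0+}(c²))(t). -/
open MeasureTheory

/-- Right-handed Riemann–Liouville fractional integral of order `α`. -/
noncomputable def RLintRight (α : ℝ) (x : ℝ → ℝ) (t : ℝ) : ℝ :=
  (1 / Real.Gamma α) * ∫ τ in (0 : ℝ)..t, (t - τ) ^ (α - 1) * x τ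

/-- Right-handed Caputo fractional derivative of order `α`:
`(^C D^α_{0+} x)(t) = (d/dt)(I^{1-α}_{0+} (x - x(0)))(t)`. -/
noncomputable def caputoDeriv (α : ℝ) (x : ℝ → ℝ) (t : ℝ) : ℝ :=
  deriv (RLintRight (1 - α) (fun s => x s - x 0)) t

section

open Set

/-- A primitive shifted by a constant is absolutely continuous. -/
theorem absolutelyContinuousOnInterval_const_add_primitive {g : ℝ → ℝ} {a b : ℝ}
    (hg : IntervalIntegrable g volume a b) (C : ℝ) :
    AbsolutelyContinuousOnInterval (fun s => C + ∫ r in a..s, g r) a b := by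
  have h1 : AbsolutelyContinuousOnInterval (fun _ : ℝ => C) a b :=
    (LipschitzWith.const C).lipschitzOnWith.absolutelyContinuousOnInterval
  exact h1.fun_add (hg.absolutelyContinuousOnInterval_intervalIntegral (by simp))

theorem deriv_const_add_primitive_ae {g : ℝ → ℝ} {a b : ℝ}
    (hg : IntervalIntegrable g volume a b) (C : ℝ) :
    ∀ᵐ s, s ∈ uIoc a b → deriv (fun s => C + ∫ r in a..s, g r) s = g s := by
  filter_upwards [hg.ae_hasDerivAt_integral] with s hs hs'
  exact ((hs (uIoc_subset_uIcc hs') a (by simp)).const_add C).deriv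

theorem integral_primitive_mul_add {f g : ℝ → ℝ} {a b : ℝ}
    (hf : IntervalIntegrable f volume a b) (hg : IntervalIntegrable g volume a b) (C D : ℝ) :
    ∫ x in a..b, (f x * (D + ∫ r in a..x, g r) + (C + ∫ r in a..x, f r) * g x) =
      (C + ∫ r in a..b, f r) * (D + ∫ r in a..b, g r) - C * D := by
  have h := (absolutelyContinuousOnInterval_const_add_primitive hf C).integral_deriv_mul_eq_sub
    (absolutelyContinuousOnInterval_const_add_primitive hg D)
  simp only [intervalIntegral.integral_same, add_zero] at h
  rw [← h]
  apply intervalIntegral.integral_congr_ae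
  filter_upwards [deriv_const_add_primitive_ae hf C, deriv_const_add_primitive_ae hg D]
    with x h1 h2 hx
  rw [h1 hx, h2 hx]

theorem integral_primitive_mul {f g : ℝ → ℝ} {a b : ℝ}
    (hf : IntervalIntegrable f volume a b) (hg : IntervalIntegrable g volume a b) :
    ∫ x in a..b, (∫ r in a..x, f r) * g x = ∫ x in a..b, f x * ∫ r in x..b, g r := by
  have h := integral_primitive_mul_add hf hg 0 0
  simp only [zero_add, mul_zero, sub_zero] at h
  have cf : ContinuousOn (fun x => ∫ r in a..x, f r) (uIcc a b) :=
    intervalIntegral.continuousOn_primitive_interval' hf (by simp)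
  have cg : ContinuousOn (fun x => ∫ r in a..x, g r) (uIcc a b) :=
    intervalIntegral.continuousOn_primitive_interval' hg (by simp)
  rw [intervalIntegral.integral_add (hf.mul_continuousOn cg) (hg.continuousOn_mul cf)] at h
  have h2 : ∫ x in a..b, f x * ∫ r in x..b, g r =
      ∫ x in a..b, (f x * (∫ r in a..b, g r) - f x * ∫ r in a..x, g r) := by
    apply intervalIntegral.integral_congr
    intro x hx
    have := intervalIntegral.integral_add_adjacent_intervals
      (hg.mono_set (uIcc_subset_uIcc_left hx)) (hg.mono_set (uIcc_subset_uIcc_right hx))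
    simp only
    rw [← this]; ring
  rw [h2, intervalIntegral.integral_sub (hf.mul_const _) (hf.mul_continuousOn cg),
    intervalIntegral.integral_mul_const]
  linarith

/-- If all tail integrals of `f` are nonnegative, so is its integral against `(t - s) ^ (-α)`. -/
theorem integral_rpow_mul_nonneg_of_tail_nonneg {α t : ℝ} (hα : 0 < α) (ht : 0 < t) {f : ℝ → ℝ}
    (hf : IntervalIntegrable f volume 0 t)
    (hwf : IntervalIntegrable (fun s => (t - s) ^ (-α) * f s) volume 0 t)
    (hF : ∀ s ∈ Icc 0 t, 0 ≤ ∫ r in s..t, f r) :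
    0 ≤ ∫ s in 0..t, (t - s) ^ (-α) * f s := by
  have key : ∀ b ∈ Ioo 0 t, 0 ≤ (∫ s in 0..b, (t - s) ^ (-α) * f s) +
      ((∫ s in 0..t, |(t - s) ^ (-α) * f s|) - ∫ s in 0..b, |(t - s) ^ (-α) * f s|) := by
    intro b hb
    have hb' : b ∈ uIcc 0 t := by rw [uIcc_of_le ht.le]; exact ⟨hb.1.le, hb.2.le⟩
    have hw : ∀ s ∈ uIcc 0 b, HasDerivAt (fun s : ℝ => (t - s) ^ (-α))
        (α * (t - s) ^ (-α - 1)) s := by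
      intro s hs
      rw [uIcc_of_le hb.1.le] at hs
      have hpos : 0 < t - s := by linarith [hs.2, hb.2]
      convert! ((hasDerivAt_id s).const_sub t).rpow_const (p := -α) (Or.inl hpos.ne') using 1
      simp
    have cw : ContDiffOn ℝ 1 (fun s : ℝ => (t - s) ^ (-α)) (uIcc 0 b) := by
      intro s hs
      rw [uIcc_of_le hb.1.le] at hs
      have hpos : 0 < t - s := by linarith [hs.2, hb.2]
      exact ((contDiffAt_const.sub contDiffAt_id).rpow_const_of_ne hpos.ne').contDiffWithinAt
    have hfb : IntervalIntegrable f volume 0 b := hf.mono_set (uIcc_subset_uIcc_left hb')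
    have hfb' : IntervalIntegrable f volume b t := hf.mono_set (uIcc_subset_uIcc_right hb')
    have hwfb := hwf.mono_set (uIcc_subset_uIcc_left hb')
    have hwfb' := hwf.mono_set (uIcc_subset_uIcc_right hb')
    have aw := cw.absolutelyContinuousOnInterval
    have h := aw.integral_deriv_mul_eq_sub
      (absolutelyContinuousOnInterval_const_add_primitive hfb.neg (∫ r in 0..t, f r))
    have hG : ∀ s ∈ Icc 0 t, (∫ r in 0..t, f r) + (∫ r in 0..s, -f r) = ∫ r in s..t, f r := by
      intro s hs
      have hs' : s ∈ uIcc 0 t := by rwa [uIcc_of_le ht.le]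
      rw [intervalIntegral.integral_neg, ← intervalIntegral.integral_add_adjacent_intervals
        (hf.mono_set (uIcc_subset_uIcc_left hs')) (hf.mono_set (uIcc_subset_uIcc_right hs'))]
      ring
    have h2 : ∫ s in 0..b, (deriv (fun s : ℝ => (t - s) ^ (-α)) s *
          ((∫ r in 0..t, f r) + (∫ r in 0..s, -f r)) +
        (t - s) ^ (-α) * deriv (fun s => (∫ r in 0..t, f r) + ∫ r in 0..s, -f r) s) =
        (∫ s in 0..b, α * (t - s) ^ (-α - 1) * ∫ r in s..t, f r) -
          ∫ s in 0..b, (t - s) ^ (-α) * f s := by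
      rw [← intervalIntegral.integral_sub _ hwfb]
      · apply intervalIntegral.integral_congr_ae
        filter_upwards [deriv_const_add_primitive_ae hfb.neg (∫ r in 0..t, f r)] with s hs hs'
        have hs2 := uIoc_subset_uIcc hs'
        have hs3 := hs2
        rw [uIcc_of_le hb.1.le] at hs3
        simp only [Pi.neg_apply] at hs
        rw [hs hs', (hw s hs2).deriv, hG s ⟨hs3.1, hs3.2.trans hb.2.le⟩]
        ring
      · apply ContinuousOn.intervalIntegrable
        apply ContinuousOn.mul
        · intro s hs
          rw [uIcc_of_le hb.1.le] at hs
          have hpos : 0 < t - s := by linarith [hs.2, hb.2]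
          exact (continuousAt_const.mul ((continuousAt_const.sub continuousAt_id).rpow_const
            (Or.inl hpos.ne'))).continuousWithinAt
        · have : ContinuousOn (fun s => (∫ r in 0..t, f r) + (∫ r in 0..s, -f r)) (uIcc 0 b) :=
            continuousOn_const.add
              (intervalIntegral.continuousOn_primitive_interval' hfb.neg (by simp))
          refine this.congr fun s hs => ?_
          rw [uIcc_of_le hb.1.le] at hs
          exact (hG s ⟨hs.1, hs.2.trans hb.2.le⟩).symm
    have h3 : 0 ≤ ∫ s in 0..b, α * (t - s) ^ (-α - 1) * ∫ r in s..t, f r := by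
      apply intervalIntegral.integral_nonneg hb.1.le
      intro s hs
      have : 0 ≤ t - s := by linarith [hs.2, hb.2]
      have := hF s ⟨hs.1, hs.2.trans hb.2.le⟩
      positivity
    have h4 : (t - b) ^ (-α) * ∫ r in b..t, f r ≤ ∫ s in b..t, |(t - s) ^ (-α) * f s| := by
      rw [← intervalIntegral.integral_const_mul]
      have e : ∀ s ∈ Ioo b t, (t - b) ^ (-α) * f s ≤ |(t - s) ^ (-α) * f s| := by
        intro s hs
        have p1 : 0 < t - s := by linarith [hs.2]
        have : (t - b) ^ (-α) ≤ (t - s) ^ (-α) :=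
          Real.rpow_le_rpow_of_nonpos p1 (by linarith [hs.1]) (by linarith)
        rw [abs_mul, abs_of_nonneg (Real.rpow_nonneg p1.le _)]
        have : 0 ≤ (t - b) ^ (-α) := Real.rpow_nonneg (by linarith [hb.2]) _
        have := le_abs_self (f s)
        have := abs_nonneg (f s)
        nlinarith
      exact intervalIntegral.integral_mono_on_of_le_Ioo hb.2.le (hfb'.const_mul _) hwfb'.abs e
    have h5 := intervalIntegral.integral_add_adjacent_intervals hwfb.abs hwfb'.abs
    rw [← h5]
    have h6 := hG b ⟨hb.1.le, hb.2.le⟩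
    have h7 : 0 ≤ (t - 0) ^ (-α) * ∫ r in 0..t, f r :=
      mul_nonneg (Real.rpow_nonneg (by linarith) _) (hF 0 ⟨le_rfl, ht.le⟩)
    simp only [Pi.neg_apply] at h
    rw [h2, h6] at h
    simp only [intervalIntegral.integral_same, add_zero] at h
    linarith
  have c1 : ContinuousOn (fun b => (∫ s in 0..b, (t - s) ^ (-α) * f s) +
      ((∫ s in 0..t, |(t - s) ^ (-α) * f s|) - ∫ s in 0..b, |(t - s) ^ (-α) * f s|))
      (Icc 0 t) := by
    rw [← uIcc_of_le ht.le]
    exact (intervalIntegral.continuousOn_primitive_interval' hwf (by simp)).add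
      (continuousOn_const.sub (intervalIntegral.continuousOn_primitive_interval' hwf.abs (by simp)))
  have h8 := le_on_closure (s := Ioo 0 t) (f := fun _ => (0 : ℝ)) key continuousOn_const
    (by rwa [closure_Ioo ht.ne]) (x := t) (by rw [closure_Ioo ht.ne]; exact ⟨ht.le, le_rfl⟩)
  simpa using h8

/-- Interchanging the order of integration in the iterated integral of a fractional convolution,
together with integrability of the convolution. -/
theorem fractional_convolution_fubini {α T : ℝ} (hα1 : α < 1) (hT : 0 < T) {g : ℝ → ℝ}
    (hg : IntervalIntegrable g volume 0 T) :
    IntervalIntegrable (fun τ => ∫ s in 0..τ, (τ - s) ^ (-α) * g s) volume 0 T ∧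
    (∀ᵐ τ, τ ∈ Icc 0 T → IntervalIntegrable (fun s => (τ - s) ^ (-α) * g s) volume 0 τ) ∧
    ∀ t ∈ Icc 0 T, ∫ τ in 0..t, (∫ s in 0..τ, (τ - s) ^ (-α) * g s) =
      ∫ s in 0..t, g s * ∫ r in s..t, (t - r) ^ (-α) := by
  have hk0 : IntervalIntegrable (fun r : ℝ => r ^ (-α)) volume 0 T :=
    intervalIntegral.intervalIntegrable_rpow' (by linarith)
  set k : ℝ → ℝ := (Ioo 0 T).indicator (fun r => r ^ (-α)) with hk_def
  set G : ℝ → ℝ := (Ioc 0 T).indicator g with hG_def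
  have hk : Integrable k := (integrable_indicator_iff measurableSet_Ioo).2
    (((intervalIntegrable_iff_integrableOn_Ioc_of_le hT.le).1 hk0).mono_set Ioo_subset_Ioc_self)
  have hG : Integrable G := (integrable_indicator_iff measurableSet_Ioc).2
    ((intervalIntegrable_iff_integrableOn_Ioc_of_le hT.le).1 hg)
  have hI : Integrable (fun p : ℝ × ℝ => G p.2 * k (p.1 - p.2)) (volume.prod volume) :=
    hG.convolution_integrand (ContinuousLinearMap.mul ℝ ℝ) hk
  have hsec : ∀ τ ∈ Icc 0 T, (fun s => G s * k (τ - s)) =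
      (Ioo 0 τ).indicator (fun s => (τ - s) ^ (-α) * g s) := by
    intro τ hτ
    ext s
    by_cases hs : s ∈ Ioo 0 τ
    · rw [indicator_of_mem hs, hG_def, hk_def,
        indicator_of_mem (show s ∈ Ioc 0 T from ⟨hs.1, hs.2.le.trans hτ.2⟩),
        indicator_of_mem (show τ - s ∈ Ioo 0 T from
          ⟨by linarith [hs.2], by linarith [hs.1, hτ.2]⟩), mul_comm]
    · rw [indicator_of_notMem hs]
      by_cases h0 : 0 < s
      · have h1 : k (τ - s) = 0 := indicator_of_notMem
          (fun h => hs ⟨h0, by linarith [h.1]⟩) _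
        rw [h1, mul_zero]
      · have h1 : G s = 0 := indicator_of_notMem (fun h => h0 h.1) _
        rw [h1, zero_mul]
  have hH : ∀ τ ∈ Icc 0 T, ∫ s, G s * k (τ - s) = ∫ s in 0..τ, (τ - s) ^ (-α) * g s := by
    intro τ hτ
    rw [hsec τ hτ, integral_indicator measurableSet_Ioo, intervalIntegral.integral_of_le hτ.1,
      integral_Ioc_eq_integral_Ioo]
  refine ⟨?_, ?_, ?_⟩
  · rw [intervalIntegrable_iff_integrableOn_Ioc_of_le hT.le]
    refine (hI.integral_prod_left.integrableOn (s := Ioc 0 T)).congr_fun ?_ measurableSet_Ioc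
    intro τ hτ
    exact hH τ ⟨hτ.1.le, hτ.2⟩
  · filter_upwards [hI.prod_right_ae] with τ h hτ
    simp only [hsec τ hτ] at h
    rw [intervalIntegrable_iff_integrableOn_Ioo_of_le hτ.1]
    exact (integrable_indicator_iff measurableSet_Ioo).1 h
  · intro t ht
    have hI' : Integrable (Function.uncurry fun τ s => G s * k (τ - s))
        ((volume.restrict (Ioc 0 t)).prod volume) := by
      have := hI.restrict (s := Ioc 0 t ×ˢ univ)
      rwa [← Measure.prod_restrict, Measure.restrict_univ] at this
    have hinner : ∀ s, ∫ τ in Ioc 0 t, G s * k (τ - s) =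
        (Ioo 0 t).indicator (fun s => g s * ∫ r in s..t, (t - r) ^ (-α)) s := by
      intro s
      rw [integral_const_mul]
      by_cases hs : s ∈ Ioo 0 t
      · rw [indicator_of_mem hs, hG_def,
          indicator_of_mem (show s ∈ Ioc 0 T from ⟨hs.1, hs.2.le.trans ht.2⟩)]
        congr 1
        have e1 : ∫ τ in Ioc 0 t, k (τ - s) =
            ∫ τ in Ioc 0 t, (Ioc s t).indicator (fun τ => (τ - s) ^ (-α)) τ := by
          refine setIntegral_congr_fun measurableSet_Ioc fun τ hτ => ?_
          by_cases h : s < τ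
          · rw [indicator_of_mem (show τ ∈ Ioc s t from ⟨h, hτ.2⟩), hk_def,
              indicator_of_mem (show τ - s ∈ Ioo 0 T from
                ⟨by linarith, by linarith [hs.1, hτ.2, ht.2]⟩)]
          · rw [indicator_of_notMem (fun h' => h h'.1), hk_def,
              indicator_of_notMem (fun h' => h (by linarith [h'.1]))]
        rw [e1, setIntegral_indicator measurableSet_Ioc,
          inter_eq_right.2 (Ioc_subset_Ioc_left hs.1.le),
          ← intervalIntegral.integral_of_le hs.2.le,
          intervalIntegral.integral_comp_sub_right (fun r : ℝ => r ^ (-α)),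
          intervalIntegral.integral_comp_sub_left (fun r : ℝ => r ^ (-α))]
        simp
      · rw [indicator_of_notMem hs]
        by_cases h0 : 0 < s
        · have e1 : ∫ τ in Ioc 0 t, k (τ - s) = 0 := by
            refine setIntegral_eq_zero_of_forall_eq_zero fun τ hτ => ?_
            exact indicator_of_notMem (fun h => hs ⟨h0, by linarith [h.1, hτ.2]⟩) _
          rw [e1, mul_zero]
        · have h1 : G s = 0 := indicator_of_notMem (fun h => h0 h.1) _
          rw [h1, zero_mul]
    have e2 : ∫ τ in 0..t, (∫ s in 0..τ, (τ - s) ^ (-α) * g s) =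
        ∫ τ in 0..t, ∫ s, G s * k (τ - s) := by
      refine intervalIntegral.integral_congr fun τ hτ => ?_
      rw [uIcc_of_le ht.1] at hτ
      exact (hH τ ⟨hτ.1, hτ.2.trans ht.2⟩).symm
    rw [e2, intervalIntegral.integral_of_le ht.1, integral_integral_swap hI']
    simp_rw [hinner]
    rw [integral_indicator measurableSet_Ioo, intervalIntegral.integral_of_le ht.1,
      integral_Ioc_eq_integral_Ioo]

/-- The Caputo derivative of an absolutely continuous function with density `g` is almost
everywhere the fractional integral of `g`. -/
theorem ae_hasDerivAt_RLintRight_sub {α T : ℝ} (hα1 : α < 1) (hT : 0 < T) {x g : ℝ → ℝ}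
    (hg : IntervalIntegrable g volume 0 T)
    (hx : ∀ t ∈ Icc 0 T, x t - x 0 = ∫ s in 0..t, g s) :
    ∀ᵐ t, t ∈ Ioo 0 T → IntervalIntegrable (fun s => (t - s) ^ (-α) * g s) volume 0 t ∧
      HasDerivAt (RLintRight (1 - α) (fun s => x s - x 0))
        (1 / Real.Gamma (1 - α) * ∫ s in 0..t, (t - s) ^ (-α) * g s) t := by
  obtain ⟨h1, h2, h3⟩ := fractional_convolution_fubini hα1 hT hg
  filter_upwards [h2, h1.ae_hasDerivAt_integral] with t ht2 htd ht
  have htT : t ∈ Icc 0 T := ⟨ht.1.le, ht.2.le⟩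
  refine ⟨ht2 htT, ?_⟩
  have hd := (htd (by rwa [uIcc_of_le hT.le]) 0 (by simp)).const_mul (1 / Real.Gamma (1 - α))
  refine hd.congr_of_eventuallyEq ?_
  filter_upwards [Ioo_mem_nhds ht.1 ht.2] with τ hτ
  have hτT : τ ∈ Icc 0 T := ⟨hτ.1.le, hτ.2.le⟩
  have hk : IntervalIntegrable (fun r : ℝ => (τ - r) ^ (-α)) volume 0 τ := by
    have := (intervalIntegral.intervalIntegrable_rpow' (r := -α) (a := 0) (b := τ)
      (by linarith)).comp_sub_left τ
    simpa using this.symm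
  have hgτ : IntervalIntegrable g volume 0 τ :=
    hg.mono_set (uIcc_subset_uIcc_left (by rwa [uIcc_of_le hT.le]))
  rw [RLintRight, h3 τ hτT, ← integral_primitive_mul hgτ hk]
  congr 1
  refine intervalIntegral.integral_congr fun s hs => ?_
  rw [uIcc_of_le hτ.1.le] at hs
  rw [hx s ⟨hs.1, hs.2.trans hτ.2.le⟩, sub_sub_cancel_left, mul_comm]

end

/-- If `0 < α < 1`, `T > 0` and `c : [0,T] → ℝ` is absolutely continuous
(i.e. `c t = c 0 + ∫_0^t c'` with `c'` integrable), then for almost every `t ∈ (0,T]`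
the Caputo derivatives of `c` and of `c²` exist and satisfy
`c(t) · (^C D^α_{0+} c)(t) ≥ (1/2) (^C D^α_{0+} (c²))(t)`. -/
theorem caputo_deriv_square_inequality
    (α T : ℝ) (hα : 0 < α) (hα1 : α < 1) (hT : 0 < T)
    (c c' : ℝ → ℝ)
    (hc' : IntervalIntegrable c' volume 0 T)
    (hc : ∀ t ∈ Set.Icc (0 : ℝ) T, c t = c 0 + ∫ s in (0 : ℝ)..t, c' s) :
    ∀ᵐ t ∂(volume.restrict (Set.Ioc (0 : ℝ) T)),
      (∃ d : ℝ, HasDerivAt (RLintRight (1 - α) (fun s => c s - c 0)) d t) ∧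
      (∃ d : ℝ, HasDerivAt (RLintRight (1 - α) (fun s => c s ^ 2 - c 0 ^ 2)) d t) ∧
      c t * caputoDeriv α c t ≥ (1 / 2) * caputoDeriv α (fun s => c s ^ 2) t := by
  have hcont : ContinuousOn c (Set.uIcc 0 T) := by
    refine (absolutelyContinuousOnInterval_const_add_primitive hc' (c 0)).continuousOn.congr ?_
    intro s hs
    exact hc s (by rwa [Set.uIcc_of_le hT.le] at hs)
  have hsq_int : IntervalIntegrable (fun s => 2 * (c s * c' s)) volume 0 T :=
    (hc'.continuousOn_mul hcont).const_mul 2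
  have hchain : ∀ t ∈ Set.Icc 0 T, c t ^ 2 - c 0 ^ 2 = ∫ s in (0 : ℝ)..t, 2 * (c s * c' s) := by
    intro t ht
    have hct : IntervalIntegrable c' volume 0 t :=
      hc'.mono_set (Set.uIcc_subset_uIcc_left (by rwa [Set.uIcc_of_le hT.le]))
    have h := integral_primitive_mul_add hct hct (c 0) (c 0)
    rw [← hc t ht] at h
    rw [sq, sq, ← h]
    refine intervalIntegral.integral_congr fun s hs => ?_
    rw [Set.uIcc_of_le ht.1] at hs
    rw [← hc s ⟨hs.1, hs.2.trans ht.2⟩]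
    ring
  have hΓ : 0 < Real.Gamma (1 - α) := Real.Gamma_pos_of_pos (by linarith)
  rw [← restrict_Ioo_eq_restrict_Ioc, ae_restrict_iff' measurableSet_Ioo]
  filter_upwards [ae_hasDerivAt_RLintRight_sub hα1 hT hc' (x := c)
      (fun t ht => by rw [hc t ht]; ring),
    ae_hasDerivAt_RLintRight_sub hα1 hT hsq_int (x := fun s => c s ^ 2) hchain] with t h1 h2 ht
  obtain ⟨i1, d1⟩ := h1 ht
  obtain ⟨i2, d2⟩ := h2 ht
  refine ⟨⟨_, d1⟩, ⟨_, d2⟩, ?_⟩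
  rw [caputoDeriv, caputoDeriv, d1.deriv, d2.deriv]
  have htT : t ∈ Set.uIcc 0 T := by rw [Set.uIcc_of_le hT.le]; exact ⟨ht.1.le, ht.2.le⟩
  have j1 : IntervalIntegrable c' volume 0 t := hc'.mono_set (Set.uIcc_subset_uIcc_left htT)
  have j2 := hsq_int.mono_set (Set.uIcc_subset_uIcc_left htT)
  have hsplit : (fun s => (t - s) ^ (-α) * (c t * c' s - 1 / 2 * (2 * (c s * c' s)))) =
      fun s => c t * ((t - s) ^ (-α) * c' s) -
        1 / 2 * ((t - s) ^ (-α) * (2 * (c s * c' s))) := by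
    ext s; ring
  have hpos := integral_rpow_mul_nonneg_of_tail_nonneg hα ht.1
    (f := fun s => c t * c' s - 1 / 2 * (2 * (c s * c' s)))
    ((j1.const_mul _).sub (j2.const_mul _))
    (by rw [hsplit]; exact (i1.const_mul _).sub (i2.const_mul _))
    (by
      intro s hs
      have hsu : s ∈ Set.uIcc 0 t := by rwa [Set.uIcc_of_le ht.1.le]
      have hsT : s ∈ Set.Icc 0 T := ⟨hs.1, hs.2.trans ht.2.le⟩
      have k1 := j1.mono_set (Set.uIcc_subset_uIcc_right hsu)
      have k2 := j2.mono_set (Set.uIcc_subset_uIcc_right hsu)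
      rw [intervalIntegral.integral_sub (k1.const_mul _) (k2.const_mul _),
        intervalIntegral.integral_const_mul, intervalIntegral.integral_const_mul]
      have a1 := intervalIntegral.integral_add_adjacent_intervals
        (j1.mono_set (Set.uIcc_subset_uIcc_left hsu)) k1
      have a2 := intervalIntegral.integral_add_adjacent_intervals
        (j2.mono_set (Set.uIcc_subset_uIcc_left hsu)) k2
      rw [← hchain s hsT, ← hchain t ⟨ht.1.le, ht.2.le⟩] at a2
      have b1 := hc s hsT
      have b2 := hc t ⟨ht.1.le, ht.2.le⟩
      have e1 : ∫ r in s..t, c' r = c t - c s := by linarith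
      have e2 : ∫ r in s..t, 2 * (c r * c' r) = c t ^ 2 - c s ^ 2 := by linarith
      rw [e1, e2]
      nlinarith [sq_nonneg (c t - c s)])
  rw [hsplit, intervalIntegral.integral_sub (i1.const_mul _) (i2.const_mul _),
    intervalIntegral.integral_const_mul, intervalIntegral.integral_const_mul] at hpos
  have := mul_nonneg (one_div_pos.2 hΓ).le hpos
  linarith
end

section
/- Let 0 < α < 1, T > 0, N ∈ ℕ and let c = (c¹,…,c^N) : [0,T] → ℝ^N be absolutely continuous. Then for almost every t ∈ (0,T] one has ⟨c(t), (^{C}D^α_{0+}c)(t)⟩ ≥ (1/2) (^{C}D^α_{0+} ‖c‖²)(t), where ⟨·,·⟩ and ‖·‖ are the Euclidean inner product and norm on ℝ^N, the Caputo derivative of c is taken componentwise, and ‖c‖² denotes the scalar function t ↦ ‖c(t)‖². -/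
open MeasureTheory
open scoped RealInnerProductSpace

/-- Right-handed Riemann–Liouville fractional integral of order `α` of a vector-valued
function (componentwise, as a Bochner integral). -/
noncomputable def RLintRightVec {E : Type*} [NormedAddCommGroup E] [NormedSpace ℝ E]
    (α : ℝ) (x : ℝ → E) (t : ℝ) : E :=
  (1 / Real.Gamma α) • ∫ τ in (0 : ℝ)..t, ((t - τ) ^ (α - 1)) • x τ

/-- Right-handed Caputo fractional derivative of order `α` of a vector-valued function
(componentwise): `(^C D^α_{0+} x)(t) = (d/dt)(I^{1-α}_{0+} (x - x(0)))(t)`. -/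
noncomputable def caputoDerivVec {E : Type*} [NormedAddCommGroup E] [NormedSpace ℝ E]
    (α : ℝ) (x : ℝ → E) (t : ℝ) : E :=
  deriv (fun s => RLintRightVec (1 - α) (fun r => x r - x 0) s) t

open Filter Topology Set in
/-- If `f` is a primitive of the integrable function `g` on `[0, T]`, then for almost every `t` the
Riemann–Liouville integral of `g` converges absolutely at `t` and is the derivative of the
Riemann–Liouville integral of `f - f 0`. -/
theorem ae_hasDerivAt_RLintRightVec {E : Type*} [NormedAddCommGroup E] [NormedSpace ℝ E]
    [CompleteSpace E] {β T : ℝ} (hβ : 0 < β) (hT : 0 < T) {f g : ℝ → E}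
    (hg : IntervalIntegrable g volume 0 T)
    (hf : ∀ t ∈ Icc (0 : ℝ) T, f t = f 0 + ∫ s in (0 : ℝ)..t, g s) :
    ∀ᵐ t : ℝ, t ∈ Ioo 0 T →
      IntervalIntegrable (fun τ => ((t - τ) ^ (β - 1)) • g τ) volume 0 t ∧
      HasDerivAt (fun s => RLintRightVec β (fun r => f r - f 0) s) (RLintRightVec β g t) t := by
  set k : ℝ → ℝ := (Ioc 0 T).indicator fun u => u ^ (β - 1) with hk
  set G : ℝ → E := (Ioc 0 T).indicator g with hG
  have hk_int : Integrable k := by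
    rw [hk, integrable_indicator_iff measurableSet_Ioc,
      ← intervalIntegrable_iff_integrableOn_Ioc_of_le hT.le]
    exact intervalIntegral.intervalIntegrable_rpow' (by linarith)
  have hG_int : Integrable G := by
    rw [hG, integrable_indicator_iff measurableSet_Ioc,
      ← intervalIntegrable_iff_integrableOn_Ioc_of_le hT.le]
    exact hg
  have hconv : Integrable (fun p : ℝ × ℝ => k p.2 • G (p.1 - p.2)) (volume.prod volume) :=
    hk_int.convolution_integrand (ContinuousLinearMap.lsmul ℝ ℝ) hG_int
  set W : ℝ → E := fun v => ∫ u, k u • G (v - u) with hW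
  have hW_int : Integrable W := hconv.integral_prod_left
  have hker : ∀ v ∈ Icc 0 T, (fun u => k u • G (v - u)) =
      (Ioo 0 v).indicator fun u => u ^ (β - 1) • g (v - u) := by
    intro v hv
    ext u
    by_cases hu : u ∈ Ioo 0 v
    · have h1 : u ∈ Ioc 0 T := ⟨hu.1, hu.2.le.trans hv.2⟩
      have h2 : v - u ∈ Ioc 0 T := ⟨by linarith [hu.2], by linarith [hu.1, hv.2]⟩
      simp [hk, hG, hu, h1, h2]
    · rw [indicator_of_notMem hu]
      by_cases h1 : u ∈ Ioc 0 T
      · have h2 : v - u ∉ Ioc 0 T := fun h2 => hu ⟨h1.1, by linarith [h2.1]⟩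
        simp [hG, h2]
      · simp [hk, h1]
  have hW_eq : ∀ v ∈ Icc 0 T, W v = ∫ r in (0 : ℝ)..v, (v - r) ^ (β - 1) • g r := by
    intro v hv
    have := intervalIntegral.integral_comp_sub_left (a := 0) (b := v)
      (fun r => (v - r) ^ (β - 1) • g r) v
    simp only [sub_sub_cancel, sub_self, sub_zero] at this
    rw [← this, hW]
    dsimp only
    rw [hker v hv, integral_indicator measurableSet_Ioo, ← integral_Ioc_eq_integral_Ioo,
      intervalIntegral.integral_of_le hv.1]
  have hRL : ∀ s ∈ Icc 0 T, RLintRightVec β (fun r => f r - f 0) s =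
      (1 / Real.Gamma β) • ∫ v in (0 : ℝ)..s, W v := by
    intro s hs
    have hprim : ∀ x ≤ T, ∀ u ≥ 0, -u ≤ x → ∫ w in -u..x, G w =
        if 0 ≤ x then f x - f 0 else 0 := by
      intro x hx u hu hux
      rw [intervalIntegral.integral_of_le hux, hG, setIntegral_indicator measurableSet_Ioc]
      have : Ioc (-u) x ∩ Ioc 0 T = Ioc 0 x := by
        ext w
        simp only [mem_inter_iff, mem_Ioc]
        grind
      rw [this]
      split_ifs with h
      · rw [hf x ⟨h, hx⟩, intervalIntegral.integral_of_le h]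
        simp
      · rw [Ioc_eq_empty (by linarith)]
        simp
    have hswap : ∫ v in Ioc 0 s, W v = ∫ u, k u • ∫ v in Ioc 0 s, G (v - u) := by
      have := integral_integral_swap (μ := volume.restrict (Ioc 0 s)) (ν := volume)
        (f := fun v u => k u • G (v - u))
        (hconv.mono_measure (Measure.prod_mono Measure.restrict_le_self le_rfl))
      rw [hW, this]
      simp_rw [integral_smul]
    have hind : (fun u => k u • ∫ v in Ioc 0 s, G (v - u)) =
        (Ioc 0 s).indicator fun u => u ^ (β - 1) • (f (s - u) - f 0) := by
      ext u
      by_cases h1 : u ∈ Ioc 0 T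
      · rw [← intervalIntegral.integral_of_le hs.1, intervalIntegral.integral_comp_sub_right,
          zero_sub, hprim (s - u) (by linarith [h1.1, hs.2]) u h1.1.le (by linarith [hs.1])]
        by_cases hu : u ≤ s
        · have h2 : u ∈ Ioc 0 s := ⟨h1.1, hu⟩
          simp [hk, h1, h2, hu]
        · simp [hu]
      · have h2 : u ∉ Ioc 0 s := fun h => h1 ⟨h.1, h.2.trans hs.2⟩
        simp [hk, h1, h2]
    have hsub := intervalIntegral.integral_comp_sub_left (a := 0) (b := s)
      (fun r => (s - r) ^ (β - 1) • (f r - f 0)) s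
    simp only [sub_sub_cancel, sub_self, sub_zero] at hsub
    rw [RLintRightVec, ← hsub, intervalIntegral.integral_of_le hs.1,
      intervalIntegral.integral_of_le hs.1, hswap, hind, integral_indicator measurableSet_Ioc]
  filter_upwards [LocallyIntegrable.ae_hasDerivAt_integral hW_int.locallyIntegrable,
    hconv.prod_right_ae]
    with t hd hi ht
  have ht' : t ∈ Icc 0 T := Ioo_subset_Icc_self ht
  constructor
  · rw [hker t ht', integrable_indicator_iff measurableSet_Ioo,
      ← intervalIntegrable_iff_integrableOn_Ioo_of_le ht.1.le] at hi
    simpa using (hi.comp_sub_left t).symm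
  · have h := (hd 0).const_smul (1 / Real.Gamma β)
    rw [hW_eq t ht'] at h
    refine h.congr_of_eventuallyEq ?_
    filter_upwards [Ioo_mem_nhds ht.1 ht.2] with s hs
    exact hRL s (Ioo_subset_Icc_self hs)

open Filter Topology Set in
/-- The weakly singular integral of the derivative of a nonnegative absolutely continuous function
vanishing at `t` is nonpositive, as integration by parts shows. -/
theorem integral_rpow_mul_deriv_nonpos {α t : ℝ} (hα : 0 < α) (hα1 : α < 1) (ht : 0 < t)
    {φ ψ : ℝ → ℝ} (hφ : AbsolutelyContinuousOnInterval φ 0 t) (hφ0 : ∀ r, 0 ≤ φ r)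
    (hφt : φ t = 0) (hd : DifferentiableAt ℝ φ t)
    (hψ : ∀ᵐ r : ℝ, r ∈ Ioo 0 t → HasDerivAt φ (ψ r) r)
    (hint : IntervalIntegrable (fun r => (t - r) ^ (-α) * ψ r) volume 0 t) :
    ∫ r in (0 : ℝ)..t, (t - r) ^ (-α) * ψ r ≤ 0 := by
  have hbound : ∀ b ∈ Ioo 0 t,
      ∫ r in (0 : ℝ)..b, (t - r) ^ (-α) * ψ r ≤ (t - b) ^ (-α) * φ b := by
    intro b hb
    have hk : ∀ r ∈ Icc 0 b, HasDerivAt (fun r => (t - r) ^ (-α)) (α * (t - r) ^ (-α - 1)) r := by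
      intro r hr
      have := ((hasDerivAt_id r).const_sub t).rpow_const (p := -α)
        (Or.inl (by simp only [id]; linarith [hr.2, hb.2]))
      simpa using this
    have hk_ac : AbsolutelyContinuousOnInterval (fun r => (t - r) ^ (-α)) 0 b := by
      apply ContDiffOn.absolutelyContinuousOnInterval
      rw [uIcc_of_le hb.1.le]
      exact ContDiffOn.rpow_const_of_ne (by fun_prop) fun r hr => by linarith [hr.2, hb.2]
    have hφ_ac : AbsolutelyContinuousOnInterval φ 0 b := by
      refine hφ.mono ?_
      rw [uIcc_of_le hb.1.le, uIcc_of_le ht.le]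
      exact Icc_subset_Icc_right hb.2.le
    have hcongr : ∫ r in (0 : ℝ)..b, (t - r) ^ (-α) * ψ r =
        ∫ r in (0 : ℝ)..b, (t - r) ^ (-α) * deriv φ r := by
      apply intervalIntegral.integral_congr_ae
      filter_upwards [hψ] with r hr hr'
      rw [uIoc_of_le hb.1.le] at hr'
      rw [(hr ⟨hr'.1, hr'.2.trans_lt hb.2⟩).deriv]
    rw [hcongr, hk_ac.integral_mul_deriv_eq_deriv_mul hφ_ac]
    have h1 : 0 ≤ (t - 0) ^ (-α) * φ 0 := mul_nonneg (by positivity) (hφ0 0)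
    have h2 : 0 ≤ ∫ r in (0 : ℝ)..b, deriv (fun r => (t - r) ^ (-α)) r * φ r := by
      refine intervalIntegral.integral_nonneg hb.1.le fun r hr => ?_
      rw [(hk r hr).deriv]
      have : 0 ≤ t - r := by linarith [hr.2, hb.2]
      exact mul_nonneg (by positivity) (hφ0 r)
    linarith
  have hlim : Tendsto (fun b => ∫ r in (0 : ℝ)..b, (t - r) ^ (-α) * ψ r) (𝓝[<] t)
      (𝓝 (∫ r in (0 : ℝ)..t, (t - r) ^ (-α) * ψ r)) := by
    have h := intervalIntegral.continuousOn_primitive_interval' hint left_mem_uIcc t right_mem_uIcc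
    rw [uIcc_of_le ht.le] at h
    refine h.tendsto.mono_left ?_
    rw [← nhdsWithin_Ioo_eq_nhdsLT ht]
    exact nhdsWithin_mono _ Ioo_subset_Icc_self
  have hzero : Tendsto (fun b => (t - b) ^ (-α) * φ b) (𝓝[<] t) (𝓝 0) := by
    have hs : Tendsto (slope φ t) (𝓝[<] t) (𝓝 (deriv φ t)) :=
      hd.hasDerivAt.tendsto_slope.mono_left (nhdsWithin_mono _ fun x hx => ne_of_lt hx)
    have hp : Tendsto (fun b : ℝ => (t - b) ^ (1 - α)) (𝓝[<] t) (𝓝 0) := by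
      have hc : ContinuousAt (fun b : ℝ => (t - b) ^ (1 - α)) t :=
        ContinuousAt.rpow_const (by fun_prop) (Or.inr (by linarith))
      have := hc.tendsto
      rw [sub_self, Real.zero_rpow (by linarith)] at this
      exact this.mono_left nhdsWithin_le_nhds
    have := (hp.mul hs).neg
    rw [zero_mul, neg_zero] at this
    refine this.congr' ?_
    filter_upwards [self_mem_nhdsWithin] with b hb
    have hb' : 0 < t - b := sub_pos.2 hb
    have hb'' : b - t ≠ 0 := by linarith
    rw [slope_def_field, hφt, sub_eq_add_neg 1 α, add_comm, Real.rpow_add hb', Real.rpow_one]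
    field_simp
    ring
  refine le_of_tendsto_of_tendsto hlim hzero ?_
  filter_upwards [Ioo_mem_nhdsLT ht] with b hb using hbound b hb

open Filter Topology Set in
theorem AbsolutelyContinuousOnInterval.congr_eqOn {X : Type*} [PseudoMetricSpace X] {f g : ℝ → X}
    {a b : ℝ} (hf : AbsolutelyContinuousOnInterval f a b) (hfg : EqOn f g (uIcc a b)) :
    AbsolutelyContinuousOnInterval g a b := by
  refine Tendsto.congr' ?_ hf
  filter_upwards [mem_inf_of_right (mem_principal_self _)] with E hE
  refine Finset.sum_congr rfl fun i hi => ?_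
  rw [hfg (hE.1 i hi).1, hfg (hE.1 i hi).2]

theorem absolutelyContinuousOnInterval_const (x a b : ℝ) :
    AbsolutelyContinuousOnInterval (fun _ => x) a b :=
  contDiff_const.contDiffOn.absolutelyContinuousOnInterval

open Set in
theorem absolutelyContinuousOnInterval_inner_of_eq_integral {E : Type*} [NormedAddCommGroup E]
    [InnerProductSpace ℝ E] [CompleteSpace E] {T : ℝ} (hT : 0 < T) {c c' : ℝ → E}
    (hc' : IntervalIntegrable c' volume 0 T)
    (hc : ∀ t ∈ Icc (0 : ℝ) T, c t = c 0 + ∫ s in (0 : ℝ)..t, c' s) (x : E) :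
    AbsolutelyContinuousOnInterval (fun r => ⟪x, c r⟫) 0 T := by
  have hint : IntervalIntegrable (fun r => ⟪x, c' r⟫) volume 0 T :=
    ⟨(innerSL ℝ x).integrable_comp hc'.1, (innerSL ℝ x).integrable_comp hc'.2⟩
  refine ((absolutelyContinuousOnInterval_const ⟪x, c 0⟫ 0 T).fun_add
    (hint.absolutelyContinuousOnInterval_intervalIntegral (c := 0) left_mem_uIcc)).congr_eqOn ?_
  intro r hr
  rw [uIcc_of_le hT.le] at hr
  have hr' : IntervalIntegrable c' volume 0 r := hc'.mono_set <| by
    rw [uIcc_of_le hT.le, uIcc_of_le hr.1]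
    exact Icc_subset_Icc_right hr.2
  have := (innerSL ℝ x).intervalIntegral_comp_comm hr'
  simp only [innerSL_apply_apply] at this
  simp only [this]
  rw [hc r hr, inner_add_right]

open Set in
theorem absolutelyContinuousOnInterval_norm_sq_of_eq_integral {N : ℕ} {T : ℝ} (hT : 0 < T)
    {c c' : ℝ → EuclideanSpace ℝ (Fin N)} (hc' : IntervalIntegrable c' volume 0 T)
    (hc : ∀ t ∈ Icc (0 : ℝ) T, c t = c 0 + ∫ s in (0 : ℝ)..t, c' s) :
    AbsolutelyContinuousOnInterval (fun r => ‖c r‖ ^ 2) 0 T := by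
  have hsum : ∀ S : Finset (Fin N), AbsolutelyContinuousOnInterval
      (fun r => ∑ i ∈ S, ⟪EuclideanSpace.basisFun (Fin N) ℝ i, c r⟫ ^ 2) 0 T := by
    intro S
    induction S using Finset.induction_on with
    | empty => simpa using absolutelyContinuousOnInterval_const 0 0 T
    | insert i S hi ih =>
      have hi' := absolutelyContinuousOnInterval_inner_of_eq_integral hT hc' hc
        (EuclideanSpace.basisFun (Fin N) ℝ i)
      simp_rw [Finset.sum_insert hi, pow_two]
      simp_rw [pow_two] at ih
      exact (hi'.fun_mul hi').fun_add ih
  have := hsum Finset.univ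
  simpa only [OrthonormalBasis.sum_sq_inner_right] using this

/-- If `0 < α < 1`, `T > 0` and `c : [0,T] → ℝ^N` is absolutely continuous
(i.e. `c t = c 0 + ∫_0^t c'` with `c'` integrable), then for almost every `t ∈ (0,T]`,
`⟨c(t), (^C D^α_{0+} c)(t)⟩ ≥ (1/2) (^C D^α_{0+} ‖c‖²)(t)`, where `⟨·,·⟩` and `‖·‖` are
the Euclidean inner product and norm, the Caputo derivative of `c` is taken
componentwise, and `‖c‖²` is the scalar function `t ↦ ‖c(t)‖²`. -/
theorem caputo_deriv_norm_sq_inequality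
    (α T : ℝ) (hα : 0 < α) (hα1 : α < 1) (hT : 0 < T) (N : ℕ)
    (c c' : ℝ → EuclideanSpace ℝ (Fin N))
    (hc' : IntervalIntegrable c' volume 0 T)
    (hc : ∀ t ∈ Set.Icc (0 : ℝ) T, c t = c 0 + ∫ s in (0 : ℝ)..t, c' s) :
    ∀ᵐ t ∂(volume.restrict (Set.Ioc (0 : ℝ) T)),
      (∃ d : EuclideanSpace ℝ (Fin N),
          HasDerivAt (fun s => RLintRightVec (1 - α) (fun r => c r - c 0) s) d t) ∧
      (∃ d : ℝ,
          HasDerivAt (fun s => RLintRightVec (1 - α) (fun r => ‖c r‖ ^ 2 - ‖c 0‖ ^ 2) s) d t) ∧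
      ⟪c t, caputoDerivVec α c t⟫
        ≥ (1 / 2) * caputoDerivVec α (fun s => ‖c s‖ ^ 2) t := by
  have hT' : (0 : ℝ) ≤ T := hT.le
  have hderiv : ∀ᵐ r : ℝ, r ∈ Set.Ioo 0 T → HasDerivAt c (c' r) r := by
    filter_upwards [hc'.ae_hasDerivAt_integral] with r hr hr'
    rw [Set.uIcc_of_le hT'] at hr
    have h := (hr (Set.Ioo_subset_Icc_self hr') 0 (Set.left_mem_Icc.2 hT')).const_add (c 0)
    refine h.congr_of_eventuallyEq ?_
    filter_upwards [Ioo_mem_nhds hr'.1 hr'.2] with s hs using hc s (Set.Ioo_subset_Icc_self hs)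
  have hq_ac := absolutelyContinuousOnInterval_norm_sq_of_eq_integral hT hc' hc
  have hq_deriv : ∀ᵐ r : ℝ, r ∈ Set.Ioc 0 T → deriv (fun r => ‖c r‖ ^ 2) r = 2 * ⟪c r, c' r⟫ := by
    filter_upwards [hderiv, Measure.ae_ne volume T] with r hr hrT hr'
    exact (hr ⟨hr'.1, lt_of_le_of_ne hr'.2 hrT⟩).norm_sq.deriv
  have hq_int : IntervalIntegrable (fun r => 2 * ⟪c r, c' r⟫) volume 0 T := by
    refine hq_ac.intervalIntegrable_deriv.congr_ae ?_
    rw [Set.uIoc_of_le hT']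
    exact (ae_restrict_iff' measurableSet_Ioc).2 hq_deriv
  have hq : ∀ t ∈ Set.Icc (0 : ℝ) T,
      ‖c t‖ ^ 2 = ‖c 0‖ ^ 2 + ∫ r in (0 : ℝ)..t, 2 * ⟪c r, c' r⟫ := by
    intro t ht
    have hsub : Set.uIcc 0 t ⊆ Set.uIcc 0 T := by
      rw [Set.uIcc_of_le hT', Set.uIcc_of_le ht.1]
      exact Set.Icc_subset_Icc_right ht.2
    have h := (hq_ac.mono hsub).integral_deriv_eq_sub
    rw [← intervalIntegral.integral_congr_ae (f := deriv fun r => ‖c r‖ ^ 2), h]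
    · ring
    · filter_upwards [hq_deriv] with r hr hr'
      rw [Set.uIoc_of_le ht.1] at hr'
      exact hr ⟨hr'.1, hr'.2.trans ht.2⟩
  rw [ae_restrict_iff' measurableSet_Ioc]
  filter_upwards [hderiv, Measure.ae_ne volume T,
    ae_hasDerivAt_RLintRightVec (sub_pos.2 hα1) hT hc' hc,
    ae_hasDerivAt_RLintRightVec (sub_pos.2 hα1) hT hq_int hq] with t hct htT hv hs ht
  have ht' : t ∈ Set.Ioo 0 T := ⟨ht.1, lt_of_le_of_ne ht.2 htT⟩
  obtain ⟨hvi, hvd⟩ := hv ht'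
  obtain ⟨hsi, hsd⟩ := hs ht'
  refine ⟨⟨_, hvd⟩, ⟨_, hsd⟩, ?_⟩
  rw [caputoDerivVec, caputoDerivVec, hvd.deriv, hsd.deriv, RLintRightVec, RLintRightVec]
  have hexp : 1 - α - 1 = -α := by ring
  simp only [hexp, smul_eq_mul] at hvi hsi ⊢
  have hvi' : IntervalIntegrable (fun r => ⟪c t, (t - r) ^ (-α) • c' r⟫) volume 0 t :=
    ⟨(innerSL ℝ (c t)).integrable_comp hvi.1, (innerSL ℝ (c t)).integrable_comp hvi.2⟩
  have hvI := (innerSL ℝ (c t)).intervalIntegral_comp_comm hvi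
  simp only [innerSL_apply_apply] at hvI
  have hsplit : (fun r => (t - r) ^ (-α) * (2 * ⟪c r, c' r⟫ - 2 * ⟪c t, c' r⟫)) =
      fun r => (t - r) ^ (-α) * (2 * ⟪c r, c' r⟫) - 2 * ⟪c t, (t - r) ^ (-α) • c' r⟫ := by
    ext r
    rw [inner_smul_right]
    ring
  have hφ : (fun r => ‖c r - c t‖ ^ 2) =
      fun r => ‖c r‖ ^ 2 + (‖c t‖ ^ 2 - 2 * ⟪c t, c r⟫) := by
    ext r
    rw [norm_sub_sq_real, real_inner_comm]
    ring
  have hφ_deriv : ∀ r, HasDerivAt c (c' r) r →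
      HasDerivAt (fun r => ‖c r - c t‖ ^ 2) (2 * ⟪c r, c' r⟫ - 2 * ⟪c t, c' r⟫) r := by
    intro r hr
    have := (hr.sub_const (c t)).norm_sq
    rwa [inner_sub_left, mul_sub] at this
  have hkey := integral_rpow_mul_deriv_nonpos hα hα1 ht.1 (φ := fun r => ‖c r - c t‖ ^ 2)
    (ψ := fun r => 2 * ⟪c r, c' r⟫ - 2 * ⟪c t, c' r⟫)
    (by
      rw [hφ]
      refine (hq_ac.fun_add ((absolutelyContinuousOnInterval_const _ 0 T).fun_sub
        ((absolutelyContinuousOnInterval_inner_of_eq_integral hT hc' hc (c t)).const_mul 2))).mono ?_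
      rw [Set.uIcc_of_le hT', Set.uIcc_of_le ht.1.le]
      exact Set.Icc_subset_Icc_right ht.2)
    (fun r => by positivity) (by simp) (hφ_deriv t (hct ht')).differentiableAt
    (by
      filter_upwards [hderiv] with r hr hr'
      exact hφ_deriv r (hr ⟨hr'.1, hr'.2.trans ht'.2⟩))
    (by
      rw [hsplit]
      exact hsi.sub (hvi'.const_mul 2))
  rw [hsplit, intervalIntegral.integral_sub hsi (hvi'.const_mul 2),
    intervalIntegral.integral_const_mul, hvI] at hkey
  rw [inner_smul_right]
  have hΓ : 0 ≤ 1 / Real.Gamma (1 - α) :=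
    one_div_nonneg.2 (Real.Gamma_pos_of_pos (sub_pos.2 hα1)).le
  nlinarith [mul_nonneg hΓ (neg_nonneg.2 hkey)]
end
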